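/- arXiv:2009.08191 — 6 statements merged into one kernel-verified Lean document; each statement's English description precedes it below -/
import Mathlib

section
/- Let C and D be transitive binary codes of length n, both containing the all-zero vector, and suppose that x + π(C) = D for some vector x ∈ F^n and some permutation π ∈ S_n. Then there exists a permutation π' ∈ S_n such that π'(C) = D. -/
open Finset

/-- `V r` is the vector space `F^r` over `F = GF(2)`. -/
abbrev V (r : ℕ) : Type := Fin r → ZMod 2

/-- The point set of `SQS_τ` (and the coordinate set of codes of length `2^{r+1}`):
left-half points `({a},∅)` are `Sum.inl a`, right-half points `(∅,{a})` are `Sum.inr a`. -/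
abbrev Pt (r : ℕ) : Type := V r ⊕ V r

/-- Action of a coordinate permutation `π` on a word: `π(y)_i = y_{π⁻¹(i)}`. -/
def permAct {ι : Type} (π : Equiv.Perm ι) (y : ι → ZMod 2) : ι → ZMod 2 :=
  fun i => y (π.symm i)

/-- The extended Hamming code of length `2^r`, with coordinates indexed by the vectors
of `F^r`: all even weight words whose support sums to zero. -/
def extHamming (r : ℕ) : Set (V r → ZMod 2) :=
  {x | ∑ a : V r, x a • a = 0 ∧ ∑ a : V r, x a = 0}

/-- `e_a` : the weight-one word with support `{a}`. -/
def unitVec {r : ℕ} (a : V r) : V r → ZMod 2 :=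
  fun b => if b = a then 1 else 0

/-- The code `S_τ = ⋃_{a ∈ F^r} (H + e_a + e_0) × (H + e_{τ(a)} + e_0)` of length `2^{r+1}`. -/
def Scode {r : ℕ} (τ : Equiv.Perm (V r)) : Set (Pt r → ZMod 2) :=
  ⋃ a : V r, {z | ∃ h₁ ∈ extHamming r, ∃ h₂ ∈ extHamming r,
    z = Sum.elim (h₁ + unitVec a + unitVec 0) (h₂ + unitVec (τ a) + unitVec 0)}

/-- `Q_0` : quadruples `({a,b,c,d},∅)`, `a,b,c,d` pairwise distinct, `a+b+c+d=0`. -/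
def Q0 (r : ℕ) : Set (Finset (Pt r)) :=
  {q | ∃ a b c d : V r, a ≠ b ∧ a ≠ c ∧ a ≠ d ∧ b ≠ c ∧ b ≠ d ∧ c ≠ d ∧
    a + b + c + d = 0 ∧ q = {Sum.inl a, Sum.inl b, Sum.inl c, Sum.inl d}}

/-- `Q_1` : quadruples `(∅,{a,b,c,d})`, `a,b,c,d` pairwise distinct, `a+b+c+d=0`. -/
def Q1 (r : ℕ) : Set (Finset (Pt r)) :=
  {q | ∃ a b c d : V r, a ≠ b ∧ a ≠ c ∧ a ≠ d ∧ b ≠ c ∧ b ≠ d ∧ c ≠ d ∧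
    a + b + c + d = 0 ∧ q = {Sum.inr a, Sum.inr b, Sum.inr c, Sum.inr d}}

/-- `Q_τ` : quadruples `({a,c},{b,d})` with `τ(a+c) = b+d ≠ 0`. -/
def Qt {r : ℕ} (τ : Equiv.Perm (V r)) : Set (Finset (Pt r)) :=
  {q | ∃ a b c d : V r, τ (a + c) = b + d ∧ b + d ≠ 0 ∧
    q = {Sum.inl a, Sum.inl c, Sum.inr b, Sum.inr d}}

/-- The Steiner quadruple system `SQS_τ = Q_0 ∪ Q_1 ∪ Q_τ`. -/
def SQS {r : ℕ} (τ : Equiv.Perm (V r)) : Set (Finset (Pt r)) :=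
  Q0 r ∪ Q1 r ∪ Qt τ

/-- Action of a point bijection on a set system. -/
def qAct {α β : Type} [DecidableEq β] (π : α ≃ β) (Q : Set (Finset α)) : Set (Finset β) :=
  (fun q => q.image π) '' Q

/-- All quadruples of the system `Q` containing both points `p` and `p'`. -/
def quadsThrough {r : ℕ} (Q : Set (Finset (Pt r))) (p p' : Pt r) : Set (Finset (Pt r)) :=
  {q ∈ Q | p ∈ q ∧ p' ∈ q}

/-- The affine permutation `σ_{a,A} : b ↦ a + A b` of `F^r`, where `A ∈ GL(r,2)`. -/
def affEquiv {r : ℕ} (a : V r) (A : V r ≃ₗ[ZMod 2] V r) : Equiv.Perm (V r) :=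
  A.toEquiv.trans (Equiv.addLeft a)

/-- The permutation `ξ` swapping `({a},∅)` with `(∅,{a})` for every `a`. -/
def xi (r : ℕ) : Equiv.Perm (Pt r) := Equiv.sumComm (V r) (V r)

/-- Point transitivity of the Steiner quadruple system `SQS_τ`. -/
def SQSPointTransitive {r : ℕ} (τ : Equiv.Perm (V r)) : Prop :=
  ∀ p p' : Pt r, ∃ π : Equiv.Perm (Pt r), qAct π (SQS τ) = SQS τ ∧ π p = p'

/-- A code is transitive if (a subgroup of) its automorphism group acts transitively
on its codewords: any codeword is mapped to any other by an automorphism `y ↦ x + π(y)`. -/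
def IsTransitiveCode {ι : Type} (C : Set (ι → ZMod 2)) : Prop :=
  ∀ c ∈ C, ∀ c' ∈ C, ∃ (x : ι → ZMod 2) (π : Equiv.Perm ι),
    (fun y => x + permAct π y) '' C = C ∧ x + permAct π c = c'

/-- A code is coordinate transitive if `PAut(C)` acts transitively on coordinates. -/
def CoordTransitive {ι : Type} (C : Set (ι → ZMod 2)) : Prop :=
  ∀ i j : ι, ∃ π : Equiv.Perm ι, permAct π '' C = C ∧ π i = j

/-- `C_1` : the words at Hamming distance exactly 1 from the code `C`. -/
def codeNbrs {ι : Type} [Fintype ι] (C : Set (ι → ZMod 2)) : Set (ι → ZMod 2) :=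
  {y | y ∉ C ∧ ∃ c ∈ C, hammingDist y c = 1}

/-- A code is neighbor transitive if `Aut(C)` acts transitively both on `C` and on `C_1`. -/
def NeighborTransitive {ι : Type} [Fintype ι] (C : Set (ι → ZMod 2)) : Prop :=
  IsTransitiveCode C ∧
  ∀ y ∈ codeNbrs C, ∀ y' ∈ codeNbrs C, ∃ (x : ι → ZMod 2) (π : Equiv.Perm ι),
    (fun w => x + permAct π w) '' C = C ∧ x + permAct π y = y'

/-- An extended perfect code: minimum distance 4 and `2^n/(2n)` codewords. -/
def IsExtPerfect {ι : Type} [Fintype ι] (C : Set (ι → ZMod 2)) : Prop :=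
  (∀ x ∈ C, ∀ y ∈ C, x ≠ y → 4 ≤ hammingDist x y) ∧
  (∃ x ∈ C, ∃ y ∈ C, hammingDist x y = 4) ∧
  Nat.card C * (2 * Fintype.card ι) = 2 ^ Fintype.card ι

/-- The (extended) Mollard code `M(C,D)` with function `φ`. -/
def mollard {t m : ℕ} (C : Set (Fin t → ZMod 2)) (D : Set (Fin m → ZMod 2))
    (φ : (Fin t → ZMod 2) → (Fin m → ZMod 2)) : Set (Fin t × Fin m → ZMod 2) :=
  {z | (fun i => ∑ j, z (i, j)) ∈ C ∧
       ∃ d ∈ D, (fun j => ∑ i, z (i, j)) = φ (fun i => ∑ j, z (i, j)) + d}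

/-- Isomorphism of codes over possibly different coordinate sets:
`D = x + π(C)` for a coordinate bijection `π` and a vector `x`. -/
def CodeIso {ι κ : Type} (C : Set (ι → ZMod 2)) (D : Set (κ → ZMod 2)) : Prop :=
  ∃ (e : ι ≃ κ) (x : κ → ZMod 2), (fun z => x + fun k => z (e.symm k)) '' C = D

/-- The rank of a code: the dimension of its linear span. -/
noncomputable def codeRank {ι : Type} (C : Set (ι → ZMod 2)) : ℕ :=
  Module.finrank (ZMod 2) ↥(Submodule.span (ZMod 2) C)

/-- The kernel of a code: `{x : x + C = C}`. -/
def codeKernel {ι : Type} (C : Set (ι → ZMod 2)) : Set (ι → ZMod 2) :=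
  {x | (fun y => x + y) '' C = C}

/-- The dimension of the kernel of a code. -/
noncomputable def kernelDim {ι : Type} (C : Set (ι → ZMod 2)) : ℕ :=
  codeRank (codeKernel C)

/-- A permutation of `F^r` is affine if it is of the form `b ↦ a + A b`, `A ∈ GL(r,2)`. -/
def IsAffinePerm {r : ℕ} (g : Equiv.Perm (V r)) : Prop :=
  ∃ (a : V r) (A : V r ≃ₗ[ZMod 2] V r), ∀ x, g x = a + A x

/-- A regular subgroup of `GA(r,2)`: a subgroup consisting of affine permutations that
acts sharply transitively on `F^r`. -/
def IsRegularAffineSubgroup {r : ℕ} (G : Subgroup (Equiv.Perm (V r))) : Prop :=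
  (∀ g ∈ G, IsAffinePerm g) ∧ ∀ u v : V r, ∃! g : G, (g : Equiv.Perm (V r)) u = v

/-- `τ` is induced by an automorphism `T` of a regular subgroup `G ≤ GA(r,2)`:
`T(g_a) = g_{τ(a)}`, i.e. `τ(g(0)) = (T g)(0)` for every `g ∈ G`. -/
def InducedByRegularAut {r : ℕ} (τ : Equiv.Perm (V r)) : Prop :=
  ∃ G : Subgroup (Equiv.Perm (V r)), IsRegularAffineSubgroup G ∧
    ∃ T : G ≃* G, ∀ g : G, τ ((g : Equiv.Perm (V r)) 0) = (T g : Equiv.Perm (V r)) 0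

/-- The identification `F^{r+r'} ≃ F^r × F^{r'}`, `x|y ↦ (x,y)`. -/
def splitEquiv (r r' : ℕ) : V (r + r') ≃ V r × V r' :=
  (finSumFinEquiv.symm.arrowCongr (Equiv.refl (ZMod 2))).trans
    (Equiv.sumArrowEquivProdArrow _ _ _)

/-- The concatenation `τ|τ'` of permutations: `(τ|τ')(x|y) = τ(x)|τ'(y)`. -/
def concatPerm {r r' : ℕ} (τ : Equiv.Perm (V r)) (τ' : Equiv.Perm (V r')) :
    Equiv.Perm (V (r + r')) :=
  (splitEquiv r r').trans ((τ.prodCongr τ').trans (splitEquiv r r').symm)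

/-- if `C`, `D` are transitive codes containing `0` and `x + π(C) = D`,
then `π'(C) = D` for some permutation `π'`. -/
theorem transitive_codes_iso_by_perm {n : ℕ} (C D : Set (Fin n → ZMod 2))
    (hC : IsTransitiveCode C) (hD : IsTransitiveCode D)
    (h0C : (0 : Fin n → ZMod 2) ∈ C) (h0D : (0 : Fin n → ZMod 2) ∈ D)
    (x : Fin n → ZMod 2) (π : Equiv.Perm (Fin n))
    (h : (fun y => x + permAct π y) '' C = D) :
    ∃ π' : Equiv.Perm (Fin n), permAct π' '' C = D := by
  have hx : x ∈ D := by
    rw [← h]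
    refine ⟨0, h0C, ?_⟩
    funext i
    simp [permAct]
  obtain ⟨z, σ, hσ, hz⟩ := hD x hx 0 h0D
  refine ⟨π.trans σ, ?_⟩
  have key : ∀ y, permAct (π.trans σ) y = z + permAct σ (x + permAct π y) := by
    intro y
    funext i
    have hi := congrFun hz i
    simp only [permAct, Pi.add_apply, Pi.zero_apply] at hi
    simp only [permAct, Pi.add_apply, Equiv.symm_trans_apply]
    rw [← add_assoc, hi, zero_add]
  calc permAct (π.trans σ) '' C
      = (fun y => z + permAct σ y) '' ((fun y => x + permAct π y) '' C) := by
        rw [Set.image_image]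
        exact Set.image_congr fun y _ => key y
    _ = D := by rw [h, hσ]
end

section
/- Let τ be a permutation of the vectors of F^r with τ(0) = 0. The code S_τ of length 2^{r+1} is an extended Hamming code (i.e., permutation-equivalent to the extended Hamming code of length 2^{r+1}) if and only if τ = σ_M for some M ∈ GL(r,2), i.e., τ is an invertible linear map of F^r. -/
open Finset

theorem sum_unitVec_aux {r : ℕ} (a : V r) : ∑ b : V r, unitVec a b = 1 := by
  simp [unitVec]

theorem sum_unitVec_smul_aux {r : ℕ} (a : V r) : ∑ b : V r, unitVec a b • b = a := by
  simp [unitVec, ite_smul]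

theorem two_aux (x : ZMod 2) : x + x = 0 := CharTwo.add_self_eq_zero x

theorem twoV_aux {r : ℕ} (x : V r) : x + x = 0 := by
  ext i
  exact two_aux (x i)

theorem mem_Scode_aux {r : ℕ} (τ : Equiv.Perm (V r)) (z : Pt r → ZMod 2) :
    z ∈ Scode τ ↔ ∑ a : V r, z (Sum.inl a) = 0 ∧ ∑ a : V r, z (Sum.inr a) = 0 ∧
      τ (∑ a : V r, z (Sum.inl a) • a) = ∑ a : V r, z (Sum.inr a) • a := by
  simp only [Scode, Set.mem_iUnion, Set.mem_ofPred_eq]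
  constructor
  · rintro ⟨a, h₁, ⟨h11, h12⟩, h₂, ⟨h21, h22⟩, rfl⟩
    simp only [Sum.elim_inl, Sum.elim_inr, Pi.add_apply, add_smul, Finset.sum_add_distrib,
      sum_unitVec_aux, sum_unitVec_smul_aux, h11, h12, h21, h22]
    simp [two_aux]
  · rintro ⟨h1, h2, h3⟩
    set a := ∑ a : V r, z (Sum.inl a) • a with ha
    refine ⟨a, (fun b => z (Sum.inl b)) + unitVec a + unitVec 0, ⟨?_, ?_⟩,
      (fun b => z (Sum.inr b)) + unitVec (τ a) + unitVec 0, ⟨?_, ?_⟩, ?_⟩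
    · simp only [Pi.add_apply, add_smul, Finset.sum_add_distrib, sum_unitVec_smul_aux, ← ha]
      simp [twoV_aux]
    · simp only [Pi.add_apply, Finset.sum_add_distrib, sum_unitVec_aux, h1]
      simp [two_aux]
    · simp only [Pi.add_apply, add_smul, Finset.sum_add_distrib, sum_unitVec_smul_aux, ← h3]
      simp [twoV_aux]
    · simp only [Pi.add_apply, Finset.sum_add_distrib, sum_unitVec_aux, h2]
      simp [two_aux]
    · have key : ∀ p q s : ZMod 2, p = p + q + s + q + s := by decide
      funext k
      rcases k with b | b
      · exact key _ _ _
      · exact key _ _ _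

theorem extHamming_add_aux {r : ℕ} {x y : V r → ZMod 2} (hx : x ∈ extHamming r)
    (hy : y ∈ extHamming r) : x + y ∈ extHamming r := by
  obtain ⟨h1, h2⟩ := hx
  obtain ⟨h3, h4⟩ := hy
  constructor
  · simp only [Pi.add_apply, add_smul, Finset.sum_add_distrib, h1, h3, add_zero]
  · simp only [Pi.add_apply, Finset.sum_add_distrib, h2, h4, add_zero]

theorem Scode_add_aux {r : ℕ} (τ : Equiv.Perm (V r)) (e : Pt r ≃ V (r + 1))
    (he : (fun z => fun k => z (e.symm k)) '' Scode τ = extHamming (r + 1))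
    {x y : Pt r → ZMod 2} (hx : x ∈ Scode τ) (hy : y ∈ Scode τ) : x + y ∈ Scode τ := by
  have hx' : (fun k => x (e.symm k)) ∈ extHamming (r + 1) := he ▸ ⟨x, hx, rfl⟩
  have hy' : (fun k => y (e.symm k)) ∈ extHamming (r + 1) := he ▸ ⟨y, hy, rfl⟩
  have h := extHamming_add_aux hx' hy'
  rw [← he] at h
  obtain ⟨w, hw, hwe⟩ := h
  have : w = x + y := by
    funext p
    have := congrFun hwe (e p)
    simpa using this
  rwa [← this]

theorem word_mem_aux {r : ℕ} (τ : Equiv.Perm (V r)) (a : V r) :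
    Sum.elim (unitVec a + unitVec 0) (unitVec (τ a) + unitVec 0) ∈ Scode τ := by
  rw [mem_Scode_aux]
  simp only [Sum.elim_inl, Sum.elim_inr, Pi.add_apply, add_smul, Finset.sum_add_distrib,
    sum_unitVec_aux, sum_unitVec_smul_aux]
  simp [two_aux]

/-- The coordinate bijection used for linear `τ`. -/
noncomputable def linEquiv_aux {r : ℕ} (M : V r ≃ₗ[ZMod 2] V r) : Pt r ≃ V (r + 1) :=
  Equiv.ofBijective
    (Sum.elim (fun a => (Fin.cons 0 (M a) : V (r + 1))) (fun b => (Fin.cons 1 b : V (r + 1)))) (by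
    constructor
    · rintro (a | a) (b | b) h
      · have := (Fin.cons_inj.mp h).2
        rw [M.injective this]
      · exact absurd (Fin.cons_inj.mp h).1 (by decide)
      · exact absurd (Fin.cons_inj.mp h).1 (by decide)
      · rw [(Fin.cons_inj.mp h).2]
    · intro k
      have h01 : ∀ x : ZMod 2, x = 0 ∨ x = 1 := by decide
      rcases h01 (k 0) with h | h
      · refine ⟨Sum.inl (M.symm (Fin.tail k)), ?_⟩
        simp only [Sum.elim_inl, LinearEquiv.apply_symm_apply, ← h]
        exact Fin.cons_self_tail k
      · refine ⟨Sum.inr (Fin.tail k), ?_⟩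
        simp only [Sum.elim_inr, ← h]
        exact Fin.cons_self_tail k)

theorem eq_of_add_aux {r : ℕ} (x y : V r) : x + y = 0 ↔ x = y := by
  constructor
  · intro h
    calc x = x + (y + y) := by rw [twoV_aux, add_zero]
      _ = y := by rw [← add_assoc, h, zero_add]
  · rintro rfl
    exact twoV_aux x

theorem lin_mem_aux {r : ℕ} (τ : Equiv.Perm (V r)) (M : V r ≃ₗ[ZMod 2] V r)
    (hM : ∀ b, τ b = M b) (z : Pt r → ZMod 2) :
    (fun k => z ((linEquiv_aux M).symm k)) ∈ extHamming (r + 1) ↔ z ∈ Scode τ := by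
  rw [mem_Scode_aux, hM, ← eq_of_add_aux]
  have hl : ∀ a, linEquiv_aux M (Sum.inl a) = (Fin.cons 0 (M a) : V (r + 1)) := fun _ => rfl
  have hr : ∀ b, linEquiv_aux M (Sum.inr b) = (Fin.cons 1 b : V (r + 1)) := fun _ => rfl
  have h1 : ∑ k : V (r + 1), z ((linEquiv_aux M).symm k) • k =
      Fin.cons (∑ b : V r, z (Sum.inr b))
        (M (∑ a : V r, z (Sum.inl a) • a) + ∑ b : V r, z (Sum.inr b) • b) := by
    rw [← (linEquiv_aux M).sum_comp]
    simp only [Equiv.symm_apply_apply, Fintype.sum_sum_type]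
    funext i
    refine Fin.cases ?_ (fun j => ?_) i
    · simp [hl, hr, Finset.sum_apply]
    · simp [hl, hr, Finset.sum_apply]
  have h2 : ∑ k : V (r + 1), z ((linEquiv_aux M).symm k) =
      ∑ a : V r, z (Sum.inl a) + ∑ b : V r, z (Sum.inr b) := by
    rw [← (linEquiv_aux M).sum_comp]
    simp only [Equiv.symm_apply_apply, Fintype.sum_sum_type]
  have h3 : (0 : V (r + 1)) = Fin.cons 0 0 := by
    funext i
    refine Fin.cases ?_ (fun j => ?_) i <;> simp
  simp only [extHamming, Set.mem_ofPred_eq, h1, h2]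
  rw [h3, Fin.cons_inj]
  constructor
  · rintro ⟨⟨ha, hb⟩, hc⟩
    rw [ha, add_zero] at hc
    exact ⟨hc, ha, hb⟩
  · rintro ⟨hc, ha, hb⟩
    exact ⟨⟨ha, hb⟩, by rw [ha, hc, add_zero]⟩

/-- `S_τ` is (permutation-equivalent to) the extended Hamming code of
length `2^{r+1}` iff `τ = σ_M` for some `M ∈ GL(r,2)`, i.e. `τ` is linear. -/
theorem Scode_isExtHamming_iff_linear {r : ℕ} (τ : Equiv.Perm (V r)) (h0 : τ 0 = 0) :
    (∃ e : Pt r ≃ V (r + 1),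
        (fun z => fun k => z (e.symm k)) '' Scode τ = extHamming (r + 1)) ↔
    ∃ M : V r ≃ₗ[ZMod 2] V r, ∀ b : V r, τ b = M b := by
  constructor
  · rintro ⟨e, he⟩
    have hadd : ∀ a b, τ (a + b) = τ a + τ b := by
      intro a b
      have h := Scode_add_aux τ e he (word_mem_aux τ a) (word_mem_aux τ b)
      rw [mem_Scode_aux] at h
      have h3 := h.2.2
      simp only [Pi.add_apply, Sum.elim_inl, Sum.elim_inr, add_smul, Finset.sum_add_distrib,
        sum_unitVec_smul_aux, add_zero] at h3
      exact h3
    let f : V r →+ V r := ⟨⟨τ, h0⟩, hadd⟩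
    exact ⟨LinearEquiv.ofBijective (f.toZModLinearMap 2) τ.bijective, fun b => rfl⟩
  · rintro ⟨M, hM⟩
    refine ⟨linEquiv_aux M, ?_⟩
    ext w
    constructor
    · rintro ⟨z, hz, rfl⟩
      exact (lin_mem_aux τ M hM z).mpr hz
    · intro hw
      have hw' : (fun k => w (linEquiv_aux M ((linEquiv_aux M).symm k))) = w := by
        funext k
        simp
      refine ⟨fun p => w (linEquiv_aux M p), ?_, hw'⟩
      rw [← lin_mem_aux τ M hM]
      simpa using hw
end

section
/- Let τ be a permutation of the vectors of F^r fixing 0 that is not a linear map (equivalently, SQS_τ is non-affine). Then for any a, b ∈ F^r there exist two distinct quadruples in Q_τ(a,b) whose symmetric difference (taken separately on the left and right halves of the point set) is not a quadruple of SQS_τ. -/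
open Finset

theorem pair_sum_aux {r : ℕ} {p q p' q' : V r} (hpq : p ≠ q)
    (hp : p = p' ∨ p = q') (hq : q = p' ∨ q = q') : p' + q' = p + q := by
  rcases hp with rfl | rfl <;> rcases hq with rfl | rfl
  · exact absurd rfl hpq
  · rfl
  · exact add_comm _ _
  · exact absurd rfl hpq

/-- if `τ` is not linear (so `SQS_τ` is non-affine), then for any
`a, b ∈ F^r` there are two distinct quadruples of `Q_τ(a,b)` whose symmetric
difference is not a quadruple of `SQS_τ`. -/
theorem exists_symmDiff_not_mem_of_Qtab {r : ℕ} (τ : Equiv.Perm (V r)) (h0 : τ 0 = 0)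
    (hnl : ¬ ∀ x y : V r, τ (x + y) = τ x + τ y) :
    ∀ a b : V r,
      ∃ q ∈ quadsThrough (SQS τ) (Sum.inl a) (Sum.inr b),
        ∃ q' ∈ quadsThrough (SQS τ) (Sum.inl a) (Sum.inr b),
          q ≠ q' ∧ symmDiff q q' ∉ SQS τ := by
  intro a b
  push Not at hnl
  obtain ⟨x, y, hxy⟩ := hnl
  have self : ∀ z : V r, z + z = 0 := fun z => funext fun i => CharTwo.add_self_eq_zero (z i)
  have hx : x ≠ 0 := by
    rintro rfl
    simp [h0] at hxy
  have hy : y ≠ 0 := by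
    rintro rfl
    simp [h0] at hxy
  have hne : x ≠ y := by
    rintro rfl
    rw [self, self, h0] at hxy
    exact hxy rfl
  have htx : τ x ≠ 0 := fun h => hx (τ.injective (h.trans h0.symm))
  have hty : τ y ≠ 0 := fun h => hy (τ.injective (h.trans h0.symm))
  have htne : τ x ≠ τ y := fun h => hne (τ.injective h)
  have cancel : ∀ u v : V r, u + (u + v) = v := fun u v => by
    rw [← add_assoc, self, zero_add]
  have hmem : ∀ z : V r, z ≠ 0 →
      ({Sum.inl a, Sum.inl (a + z), Sum.inr b, Sum.inr (b + τ z)} : Finset (Pt r)) ∈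
        quadsThrough (SQS τ) (Sum.inl a) (Sum.inr b) := by
    intro z hz
    refine ⟨Or.inr ⟨a, b, a + z, b + τ z, ?_, ?_, rfl⟩, by simp, by simp⟩
    · rw [cancel, cancel]
    · rw [cancel]
      exact fun h => hz (τ.injective (h.trans h0.symm))
  refine ⟨_, hmem x hx, _, hmem y hy, ?_, ?_⟩
  · intro h
    have h1 := (Finset.ext_iff.mp h (Sum.inl (a + x))).mp (by simp)
    simp [hx, hne] at h1
  · have m1 : (Sum.inl (a + x) : Pt r) ∈ symmDiff
        ({Sum.inl a, Sum.inl (a + x), Sum.inr b, Sum.inr (b + τ x)} : Finset (Pt r))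
        {Sum.inl a, Sum.inl (a + y), Sum.inr b, Sum.inr (b + τ y)} := by
      simp [Finset.mem_symmDiff, hx, hne]
    have m2 : (Sum.inl (a + y) : Pt r) ∈ symmDiff
        ({Sum.inl a, Sum.inl (a + x), Sum.inr b, Sum.inr (b + τ x)} : Finset (Pt r))
        {Sum.inl a, Sum.inl (a + y), Sum.inr b, Sum.inr (b + τ y)} := by
      simp [Finset.mem_symmDiff, hy, hne.symm]
    have m3 : (Sum.inr (b + τ x) : Pt r) ∈ symmDiff
        ({Sum.inl a, Sum.inl (a + x), Sum.inr b, Sum.inr (b + τ x)} : Finset (Pt r))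
        {Sum.inl a, Sum.inl (a + y), Sum.inr b, Sum.inr (b + τ y)} := by
      simp [Finset.mem_symmDiff, htx, hne]
    have m4 : (Sum.inr (b + τ y) : Pt r) ∈ symmDiff
        ({Sum.inl a, Sum.inl (a + x), Sum.inr b, Sum.inr (b + τ x)} : Finset (Pt r))
        {Sum.inl a, Sum.inl (a + y), Sum.inr b, Sum.inr (b + τ y)} := by
      simp [Finset.mem_symmDiff, hty, hne.symm]
    rintro ((⟨_, _, _, _, _, _, _, _, _, _, _, h⟩ | ⟨_, _, _, _, _, _, _, _, _, _, _, h⟩) |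
      ⟨a', b', c', d', h1, _, h⟩)
    · rw [h] at m3
      simp at m3
    · rw [h] at m1
      simp at m1
    · rw [h] at m1 m2 m3 m4
      simp only [Finset.mem_insert, Finset.mem_singleton, Sum.inl.injEq, Sum.inr.injEq,
        reduceCtorEq, or_false, false_or] at m1 m2 m3 m4
      have e1 := pair_sum_aux (fun h => hne (add_left_cancel h)) m1 m2
      have e2 := pair_sum_aux (fun h => htne (add_left_cancel h)) m3 m4
      have sum4 : ∀ u v w : V r, (u + v) + (u + w) = v + w := fun u v w => by
        rw [add_add_add_comm, self, zero_add]
      rw [e1, e2, sum4, sum4] at h1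
      exact hxy h1
end

section
/- Let τ be a permutation of the vectors of F^r with τ(0) = 0. For any a, b ∈ F^r the permutation (σ_a | σ_b) is an automorphism of SQS_τ. In particular, Aut(SQS_τ) either acts transitively on the points of SQS_τ, or has exactly two point orbits, namely the left-half points {({a},∅) : a ∈ F^r} and the right-half points {(∅,{a}) : a ∈ F^r}. -/
open Finset

theorem V_add_self {r : ℕ} (a : V r) : a + a = 0 := by
  funext i
  exact CharTwo.add_self_eq_zero (a i)

theorem V_shift2 {r : ℕ} (a x y : V r) : (a + x) + (a + y) = x + y := by
  have h := V_add_self a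
  calc (a + x) + (a + y) = (a + a) + (x + y) := by abel
    _ = x + y := by rw [h, zero_add]

theorem V_shift4 {r : ℕ} (a x y z w : V r) :
    (a + x) + (a + y) + (a + z) + (a + w) = x + y + z + w := by
  rw [V_shift2, add_assoc, V_shift2, ← add_assoc]

theorem trans_mem {r : ℕ} (τ : Equiv.Perm (V r)) (a b : V r) (q : Finset (Pt r))
    (hq : q ∈ SQS τ) :
    q.image (Equiv.sumCongr (Equiv.addLeft a) (Equiv.addLeft b)) ∈ SQS τ := by
  rcases hq with (hq | hq) | hq
  · obtain ⟨x, y, z, w, h1, h2, h3, h4, h5, h6, hs, rfl⟩ := hq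
    refine Or.inl (Or.inl ⟨a + x, a + y, a + z, a + w, ?_, ?_, ?_, ?_, ?_, ?_, ?_, ?_⟩)
    on_goal 7 => rw [V_shift4, hs]
    on_goal 7 => simp [Finset.image_insert]
    all_goals simpa using by assumption
  · obtain ⟨x, y, z, w, h1, h2, h3, h4, h5, h6, hs, rfl⟩ := hq
    refine Or.inl (Or.inr ⟨b + x, b + y, b + z, b + w, ?_, ?_, ?_, ?_, ?_, ?_, ?_, ?_⟩)
    on_goal 7 => rw [V_shift4, hs]
    on_goal 7 => simp [Finset.image_insert]
    all_goals simpa using by assumption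
  · obtain ⟨x, y, z, w, h1, h2, rfl⟩ := hq
    refine Or.inr ⟨a + x, b + y, a + z, b + w, ?_, ?_, ?_⟩
    · rw [V_shift2, V_shift2, h1]
    · rwa [V_shift2]
    · simp [Finset.image_insert]

theorem trans_aut {r : ℕ} (τ : Equiv.Perm (V r)) (a b : V r) :
    qAct (Equiv.sumCongr (Equiv.addLeft a) (Equiv.addLeft b)) (SQS τ) = SQS τ := by
  apply Set.Subset.antisymm
  · rintro _ ⟨q, hq, rfl⟩
    exact trans_mem τ a b q hq
  · intro q hq
    refine ⟨_, trans_mem τ a b q hq, ?_⟩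
    simp only [Finset.image_image]
    refine Eq.trans (Finset.image_congr (g := id) ?_) Finset.image_id
    intro p _
    rcases p with p | p <;> simp [← add_assoc, V_add_self]

theorem qAct_comp {r : ℕ} {Q : Set (Finset (Pt r))} {f g : Equiv.Perm (Pt r)}
    (hf : qAct f Q = Q) (hg : qAct g Q = Q) : qAct (f.trans g) Q = Q := by
  have : qAct (f.trans g) Q = qAct g (qAct f Q) := by
    simp [qAct, Set.image_image, Finset.image_image]
  rw [this, hf, hg]

theorem qAct_inv {r : ℕ} {Q : Set (Finset (Pt r))} {f : Equiv.Perm (Pt r)}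
    (hf : qAct f Q = Q) : qAct f.symm Q = Q := by
  have : qAct f.symm (qAct f Q) = Q := by
    simp [qAct, Set.image_image, Finset.image_image]
  rwa [hf] at this

theorem same_half {r : ℕ} (τ : Equiv.Perm (V r)) (p p' : Pt r) (h : p.isLeft = p'.isLeft) :
    ∃ π : Equiv.Perm (Pt r), qAct π (SQS τ) = SQS τ ∧ π p = p' := by
  rcases p with p | p <;> rcases p' with p' | p' <;> simp at h
  · exact ⟨_, trans_aut τ (p' - p) 0, by simp⟩
  · exact ⟨_, trans_aut τ 0 (p' - p), by simp⟩

/-- every `(σ_a|σ_b)` is an automorphism of `SQS_τ`; in particular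
`Aut(SQS_τ)` either acts transitively on the points, or has exactly the two point
orbits consisting of the left-half points and the right-half points. -/
theorem translations_are_SQS_automorphisms {r : ℕ} (τ : Equiv.Perm (V r)) (h0 : τ 0 = 0) :
    (∀ a b : V r,
      qAct (Equiv.sumCongr (Equiv.addLeft a) (Equiv.addLeft b)) (SQS τ) = SQS τ) ∧
    ((∀ p p' : Pt r, ∃ π : Equiv.Perm (Pt r), qAct π (SQS τ) = SQS τ ∧ π p = p') ∨
     (∀ p p' : Pt r,
        (∃ π : Equiv.Perm (Pt r), qAct π (SQS τ) = SQS τ ∧ π p = p') ↔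
          p.isLeft = p'.isLeft)) := by
  refine ⟨trans_aut τ, ?_⟩
  by_cases H : ∃ (x y : V r) (π : Equiv.Perm (Pt r)),
      qAct π (SQS τ) = SQS τ ∧ π (Sum.inl x) = Sum.inr y
  · left
    obtain ⟨x, y, π, hπ, hxy⟩ := H
    have key : ∀ u v : V r, ∃ π : Equiv.Perm (Pt r),
        qAct π (SQS τ) = SQS τ ∧ π (Sum.inl u) = Sum.inr v := by
      intro u v
      obtain ⟨f, hf, hfu⟩ := same_half τ (Sum.inl u) (Sum.inl x) rfl
      obtain ⟨g, hg, hgv⟩ := same_half τ (Sum.inr y) (Sum.inr v) rfl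
      exact ⟨_, qAct_comp (qAct_comp hf hπ) hg, by simp [hfu, hxy, hgv]⟩
    rintro (p | p) (p' | p')
    · exact same_half τ _ _ rfl
    · exact key p p'
    · obtain ⟨f, hf, hfp⟩ := key p' p
      exact ⟨f.symm, qAct_inv hf, by rw [← hfp, Equiv.symm_apply_apply]⟩
    · exact same_half τ _ _ rfl
  · right
    intro p p'
    refine ⟨?_, same_half τ p p'⟩
    rintro ⟨π, hπ, hp⟩
    rcases p with p | p <;> rcases p' with p' | p'
    · rfl
    · exact absurd ⟨p, p', π, hπ, hp⟩ H
    · exact absurd ⟨p', p, π.symm, qAct_inv hπ, by rw [← hp, Equiv.symm_apply_apply]⟩ H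
    · rfl
end

section
/- Let τ be a permutation of the vectors of F^r with τ(0) = 0. For any a, b ∈ F^r and any A, B ∈ GL(r,2), the permutation (σ_{a,A} | σ_{b,B}) maps SQS_τ onto SQS_{BτA^{-1}}, where BτA^{-1} denotes the permutation σ_B ∘ τ ∘ σ_{A^{-1}} of F^r. -/
open Finset

theorem affEquiv_add_pair {r : ℕ} (a : V r) (A : V r ≃ₗ[ZMod 2] V r) (x y : V r) :
    affEquiv a A x + affEquiv a A y = A (x + y) := by
  have h : a + a = 0 := funext fun i => CharTwo.add_self_eq_zero (a i)
  have h1 : affEquiv a A x + affEquiv a A y = (a + a) + A (x + y) := by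
    simp only [affEquiv, Equiv.trans_apply, Equiv.coe_addLeft, map_add]
    change a + A x + (a + A y) = _
    abel
  rw [h1, h, zero_add]

theorem affEquiv_sum_four {r : ℕ} (a : V r) (A : V r ≃ₗ[ZMod 2] V r) (x y z w : V r) :
    affEquiv a A x + affEquiv a A y + affEquiv a A z + affEquiv a A w = 0
      ↔ x + y + z + w = 0 := by
  rw [add_assoc, affEquiv_add_pair, affEquiv_add_pair, ← map_add, ← add_assoc]
  exact A.map_eq_zero_iff

theorem qAct_Q0 {r : ℕ} (a b : V r) (A B : V r ≃ₗ[ZMod 2] V r) :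
    qAct (Equiv.sumCongr (affEquiv a A) (affEquiv b B)) (Q0 r) = Q0 r := by
  ext q
  constructor
  · rintro ⟨_, ⟨x, y, z, w, h1, h2, h3, h4, h5, h6, h, rfl⟩, rfl⟩
    refine ⟨affEquiv a A x, affEquiv a A y, affEquiv a A z, affEquiv a A w, ?_⟩
    simp [affEquiv_sum_four, Finset.image_insert, *]
  · rintro ⟨x, y, z, w, h⟩
    obtain ⟨x, rfl⟩ := (affEquiv a A).surjective x
    obtain ⟨y, rfl⟩ := (affEquiv a A).surjective y
    obtain ⟨z, rfl⟩ := (affEquiv a A).surjective z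
    obtain ⟨w, rfl⟩ := (affEquiv a A).surjective w
    simp only [affEquiv_sum_four, ne_eq, EmbeddingLike.apply_eq_iff_eq] at h
    obtain ⟨h1, h2, h3, h4, h5, h6, h, rfl⟩ := h
    refine ⟨_, ⟨x, y, z, w, h1, h2, h3, h4, h5, h6, h, rfl⟩, ?_⟩
    simp [Finset.image_insert]

theorem qAct_Q1 {r : ℕ} (a b : V r) (A B : V r ≃ₗ[ZMod 2] V r) :
    qAct (Equiv.sumCongr (affEquiv a A) (affEquiv b B)) (Q1 r) = Q1 r := by
  ext q
  constructor
  · rintro ⟨_, ⟨x, y, z, w, h1, h2, h3, h4, h5, h6, h, rfl⟩, rfl⟩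
    refine ⟨affEquiv b B x, affEquiv b B y, affEquiv b B z, affEquiv b B w, ?_⟩
    simp [affEquiv_sum_four, Finset.image_insert, *]
  · rintro ⟨x, y, z, w, h⟩
    obtain ⟨x, rfl⟩ := (affEquiv b B).surjective x
    obtain ⟨y, rfl⟩ := (affEquiv b B).surjective y
    obtain ⟨z, rfl⟩ := (affEquiv b B).surjective z
    obtain ⟨w, rfl⟩ := (affEquiv b B).surjective w
    simp only [affEquiv_sum_four, ne_eq, EmbeddingLike.apply_eq_iff_eq] at h
    obtain ⟨h1, h2, h3, h4, h5, h6, h, rfl⟩ := h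
    refine ⟨_, ⟨x, y, z, w, h1, h2, h3, h4, h5, h6, h, rfl⟩, ?_⟩
    simp [Finset.image_insert]

theorem qAct_Qt {r : ℕ} (τ : Equiv.Perm (V r)) (a b : V r) (A B : V r ≃ₗ[ZMod 2] V r) :
    qAct (Equiv.sumCongr (affEquiv a A) (affEquiv b B)) (Qt τ)
      = Qt (A.symm.toEquiv.trans (τ.trans B.toEquiv)) := by
  have key : ∀ u : V r, (A.symm.toEquiv.trans (τ.trans B.toEquiv)) (A u) = B (τ u) := by
    intro u
    change B (τ (A.symm (A u))) = _
    rw [A.symm_apply_apply]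
  ext q
  constructor
  · rintro ⟨_, ⟨x, y, z, w, h1, h2, rfl⟩, rfl⟩
    refine ⟨affEquiv a A x, affEquiv b B y, affEquiv a A z, affEquiv b B w, ?_, ?_, ?_⟩
    · rw [affEquiv_add_pair, affEquiv_add_pair, key, h1]
    · rw [affEquiv_add_pair]
      exact fun h => h2 (B.map_eq_zero_iff.1 h)
    · simp [Finset.image_insert]
  · rintro ⟨x, y, z, w, h1, h2, rfl⟩
    obtain ⟨x, rfl⟩ := (affEquiv a A).surjective x
    obtain ⟨y, rfl⟩ := (affEquiv b B).surjective y
    obtain ⟨z, rfl⟩ := (affEquiv a A).surjective z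
    obtain ⟨w, rfl⟩ := (affEquiv b B).surjective w
    rw [affEquiv_add_pair, affEquiv_add_pair, key] at h1
    rw [affEquiv_add_pair] at h2
    refine ⟨_, ⟨x, y, z, w, B.injective h1, fun h => h2 (by rw [h, map_zero]), rfl⟩, ?_⟩
    simp [Finset.image_insert]

/-- `(σ_{a,A}|σ_{b,B})` maps `SQS_τ` onto `SQS_{BτA⁻¹}`. -/
theorem sumCongr_affine_maps_SQS {r : ℕ} (τ : Equiv.Perm (V r)) (h0 : τ 0 = 0)
    (a b : V r) (A B : V r ≃ₗ[ZMod 2] V r) :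
    qAct (Equiv.sumCongr (affEquiv a A) (affEquiv b B)) (SQS τ)
      = SQS (A.symm.toEquiv.trans (τ.trans B.toEquiv)) := by
  have hu : ∀ P Q : Set (Finset (Pt r)),
      qAct (Equiv.sumCongr (affEquiv a A) (affEquiv b B)) (P ∪ Q)
        = qAct (Equiv.sumCongr (affEquiv a A) (affEquiv b B)) P
          ∪ qAct (Equiv.sumCongr (affEquiv a A) (affEquiv b B)) Q :=
    fun P Q => Set.image_union _ P Q
  unfold SQS
  rw [hu, hu, qAct_Q0, qAct_Q1, qAct_Qt]
end

section
/- Let τ be a permutation of the vectors of F^r with τ(0) = 0. The Steiner quadruple system SQS_τ of order 2^{r+1} is point transitive if and only if τ^{-1} ∈ GL(r,2)·τ·GL(r,2), i.e., τ^{-1} = σ_A ∘ τ ∘ σ_B for some A, B ∈ GL(r,2). -/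
open Finset

namespace SQSaux

variable {r : ℕ}

lemma vv (x : V r) : x + x = 0 := by
  ext i
  exact CharTwo.add_self_eq_zero (x i)

lemma eq_of_add {x y : V r} (h : x + y = 0) : x = y := by
  linear_combination h - vv y

lemma add_ne {x y : V r} (h : x ≠ y) : x + y ≠ 0 := fun h' => h (eq_of_add h')

/-- side indicator -/
def sd (p : Pt r) : ZMod 2 := Sum.elim (fun _ => 1) (fun _ => 0) p

/-- left component -/
def lc (p : Pt r) : V r := Sum.elim (fun a => a) (fun _ => 0) p

/-- right component -/
def rc (p : Pt r) : V r := Sum.elim (fun _ => 0) (fun a => a) p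

@[simp] lemma sd_inl (a : V r) : sd (Sum.inl a : Pt r) = 1 := rfl
@[simp] lemma sd_inr (a : V r) : sd (Sum.inr a : Pt r) = 0 := rfl
@[simp] lemma lc_inl (a : V r) : lc (Sum.inl a : Pt r) = a := rfl
@[simp] lemma lc_inr (a : V r) : lc (Sum.inr a : Pt r) = 0 := rfl
@[simp] lemma rc_inl (a : V r) : rc (Sum.inl a : Pt r) = 0 := rfl
@[simp] lemma rc_inr (a : V r) : rc (Sum.inr a : Pt r) = a := rfl

/-- numerical description of a block -/
def Blk (τ : Equiv.Perm (V r)) (p q x y : Pt r) : Prop :=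
  sd p + sd q + sd x + sd y = 0 ∧ τ (lc p + lc q + lc x + lc y) = rc p + rc q + rc x + rc y

/-- pairwise distinct -/
def Dst (p q x y : Pt r) : Prop := p ≠ q ∧ p ≠ x ∧ p ≠ y ∧ q ≠ x ∧ q ≠ y ∧ x ≠ y

lemma mem_of_blk (τ : Equiv.Perm (V r)) (h0 : τ 0 = 0) {p q x y : Pt r} (hd : Dst p q x y)
    (hb : Blk τ p q x y) : ({p, q, x, y} : Finset (Pt r)) ∈ SQS τ := by
  obtain ⟨h1, h2, h3, h4, h5, h6⟩ := hd
  obtain ⟨hs, ht⟩ := hb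
  have inj0 : ∀ z, τ z = 0 → z = 0 := fun z hz => τ.injective (hz.trans h0.symm)
  have o3 : (1 + 1 + 1 : ZMod 2) ≠ 0 := by decide
  rcases p with a | a <;> rcases q with b | b <;> rcases x with c | c <;> rcases y with d | d <;>
    simp only [sd_inl, sd_inr, lc_inl, lc_inr, rc_inl, rc_inr, add_zero, zero_add, ne_eq,
      Sum.inl.injEq, Sum.inr.injEq, one_ne_zero, o3] at hs ht h1 h2 h3 h4 h5 h6
  · exact Or.inl (Or.inl ⟨a, b, c, d, h1, h2, h3, h4, h5, h6, inj0 _ ht, rfl⟩)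
  · exact Or.inr ⟨a, c, b, d, ht, add_ne h6, rfl⟩
  · exact Or.inr ⟨a, b, c, d, ht, add_ne h5, by ext; simp; tauto⟩
  · exact Or.inr ⟨a, b, d, c, ht, add_ne h4, by ext; simp; tauto⟩
  · exact Or.inr ⟨b, a, c, d, ht, add_ne h3, by ext; simp; tauto⟩
  · exact Or.inr ⟨b, a, d, c, ht, add_ne h2, by ext; simp; tauto⟩
  · exact Or.inr ⟨c, a, d, b, ht, add_ne h1, by ext; simp; tauto⟩
  · rw [h0] at ht
    exact Or.inl (Or.inr ⟨a, b, c, d, h1, h2, h3, h4, h5, h6, ht.symm, rfl⟩)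

lemma exists_of_mem (τ : Equiv.Perm (V r)) (h0 : τ 0 = 0) {s : Finset (Pt r)} (hs : s ∈ SQS τ) :
    ∃ p q x y : Pt r, Dst p q x y ∧ Blk τ p q x y ∧ s = {p, q, x, y} := by
  have o4 : (1 + 1 + 1 + 1 : ZMod 2) = 0 := by decide
  have o2 : (1 + 1 : ZMod 2) = 0 := by decide
  rcases hs with (⟨a, b, c, d, h1, h2, h3, h4, h5, h6, h, rfl⟩ |
    ⟨a, b, c, d, h1, h2, h3, h4, h5, h6, h, rfl⟩) | ⟨a, b, c, d, h, hn, rfl⟩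
  · exact ⟨_, _, _, _, by simp [Dst, *], by simp [Blk, *], rfl⟩
  · exact ⟨_, _, _, _, by simp [Dst, *], by simp [Blk, *], rfl⟩
  · refine ⟨_, _, _, _, ?_, ?_, rfl⟩
    · have hb : b ≠ d := by
        rintro rfl
        exact hn (vv b)
      have ha : a ≠ c := by
        rintro rfl
        rw [vv, h0] at h
        exact hn h.symm
      simp [Dst, *]
    · simp [Blk, *]

/-- sums over a finset -/
lemma sum4 {M : Type*} [AddCommMonoid M] (f : Pt r → M) {p q x y : Pt r} (hd : Dst p q x y) :
    ∑ z ∈ ({p, q, x, y} : Finset (Pt r)), f z = f p + f q + f x + f y := by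
  obtain ⟨h1, h2, h3, h4, h5, h6⟩ := hd
  rw [Finset.sum_insert (by simp [*]), Finset.sum_insert (by simp [*]), Finset.sum_pair h6]
  simp only [add_assoc]

lemma blk_of_mem (τ : Equiv.Perm (V r)) (h0 : τ 0 = 0) {p q x y : Pt r} (hd : Dst p q x y)
    (hm : ({p, q, x, y} : Finset (Pt r)) ∈ SQS τ) : Blk τ p q x y := by
  obtain ⟨p', q', x', y', hd', hb, he⟩ := exists_of_mem τ h0 hm
  unfold Blk at *
  rw [← sum4 sd hd, ← sum4 lc hd, ← sum4 rc hd, he, sum4 sd hd', sum4 lc hd', sum4 rc hd']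
  exact hb

/-- forward preservation of blocks -/
def Pres (τ : Equiv.Perm (V r)) (π : Equiv.Perm (Pt r)) : Prop :=
  ∀ p q x y, Dst p q x y → Blk τ p q x y → Blk τ (π p) (π q) (π x) (π y)

lemma Dst.map {p q x y : Pt r} (hd : Dst p q x y) (π : Equiv.Perm (Pt r)) :
    Dst (π p) (π q) (π x) (π y) := by
  simpa [Dst] using hd

lemma Pres.comp {τ : Equiv.Perm (V r)} {π ρ : Equiv.Perm (Pt r)} (h : Pres τ π) (h' : Pres τ ρ) :
    Pres τ (π.trans ρ) :=
  fun _ _ _ _ hd hb => h' _ _ _ _ (hd.map π) (h _ _ _ _ hd hb)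

lemma image4 (π : Equiv.Perm (Pt r)) (p q x y : Pt r) :
    ({p, q, x, y} : Finset (Pt r)).image π = {π p, π q, π x, π y} := by
  simp [Finset.image_insert]

lemma Pres.act {τ : Equiv.Perm (V r)} (h0 : τ 0 = 0) {π : Equiv.Perm (Pt r)} (h : Pres τ π) :
    qAct π (SQS τ) = SQS τ := by
  apply Set.eq_of_subset_of_ncard_le
  · rintro _ ⟨s, hs, rfl⟩
    obtain ⟨p, q, x, y, hd, hb, rfl⟩ := exists_of_mem τ h0 hs
    simp only [image4]
    exact mem_of_blk τ h0 (hd.map π) (h _ _ _ _ hd hb)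
  · unfold qAct
    rw [Set.ncard_image_of_injective _ (Finset.image_injective π.injective)]
  · exact Set.toFinite _

lemma pres_of_act {τ : Equiv.Perm (V r)} (h0 : τ 0 = 0) {π : Equiv.Perm (Pt r)}
    (h : qAct π (SQS τ) = SQS τ) : Pres τ π := by
  intro p q x y hd hb
  apply blk_of_mem τ h0 (hd.map π)
  rw [← image4, ← h]
  exact ⟨_, mem_of_blk τ h0 hd hb, rfl⟩

lemma Pres.symm {τ : Equiv.Perm (V r)} (h0 : τ 0 = 0) {π : Equiv.Perm (Pt r)} (h : Pres τ π) :
    Pres τ π.symm := by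
  intro p q x y hd hb
  apply blk_of_mem τ h0 (hd.map π.symm)
  have hm := mem_of_blk τ h0 hd hb
  rw [← h.act h0] at hm
  obtain ⟨s, hs, he⟩ := hm
  have : s = {π.symm p, π.symm q, π.symm x, π.symm y} := by
    apply Finset.image_injective π.injective
    rw [image4]
    simpa using he
  exact this ▸ hs

/-- translations -/
def tr (u v : V r) : Equiv.Perm (Pt r) := Equiv.sumCongr (Equiv.addRight u) (Equiv.addRight v)

lemma tr_pres (τ : Equiv.Perm (V r)) (u v : V r) : Pres τ (tr u v) := by
  rintro p q x y - ⟨h1, h2⟩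
  have a1 : ∀ p, sd (tr u v p) = sd p := by rintro (p | p) <;> rfl
  have a2 : ∀ p, lc (tr u v p) = lc p + sd p • u := by
    rintro (p | p) <;> simp [tr]
  have a3 : ∀ p, rc (tr u v p) = rc p + (1 + sd p) • v := by
    have : (1 + 1 : ZMod 2) = 0 := by decide
    rintro (p | p) <;> simp [tr, this]
  refine ⟨by simpa only [a1] using h1, ?_⟩
  simp only [a2, a3]
  have e1 : lc p + sd p • u + (lc q + sd q • u) + (lc x + sd x • u) + (lc y + sd y • u)
      = lc p + lc q + lc x + lc y + (sd p + sd q + sd x + sd y) • u := by module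
  have e2 : rc p + (1 + sd p) • v + (rc q + (1 + sd q) • v) + (rc x + (1 + sd x) • v)
      + (rc y + (1 + sd y) • v)
      = rc p + rc q + rc x + rc y + (sd p + sd q + sd x + sd y) • v + (4 : ZMod 2) • v := by module
  have e4 : (4 : ZMod 2) = 0 := by decide
  rw [e1, e2, h1, e4, zero_smul, zero_smul, add_zero, add_zero, add_zero, h2]

/-- the swap -/
def sw (A B : V r ≃ₗ[ZMod 2] V r) : Equiv.Perm (Pt r) :=
  (Equiv.sumCongr B.symm.toEquiv A.toEquiv).trans (Equiv.sumComm _ _)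

lemma sw_pres (τ : Equiv.Perm (V r)) (A B : V r ≃ₗ[ZMod 2] V r)
    (h : ∀ x, τ.symm x = A (τ (B x))) : Pres τ (sw A B) := by
  rintro p q x y - ⟨h1, h2⟩
  have a1 : ∀ p, sd (sw A B p) = 1 + sd p := by
    have : (1 + 1 : ZMod 2) = 0 := by decide
    rintro (p | p) <;> simp [sw, this]
  have a2 : ∀ p, lc (sw A B p) = A (rc p) := by
    rintro (p | p) <;> simp [sw]
  have a3 : ∀ p, rc (sw A B p) = B.symm (lc p) := by
    rintro (p | p) <;> simp [sw]
  have e4 : (4 : ZMod 2) = 0 := by decide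
  refine ⟨?_, ?_⟩
  · simp only [a1]
    linear_combination h1 + e4
  · simp only [a2, a3, ← map_add]
    rw [← h2]
    have := h (B.symm (lc p + lc q + lc x + lc y))
    rw [LinearEquiv.apply_symm_apply] at this
    rw [← this, Equiv.apply_symm_apply]

lemma mkLin (g : V r → V r) (hg : Function.Injective g) (ha : ∀ x y, g (x + y) = g x + g y) :
    ∃ G : V r ≃ₗ[ZMod 2] V r, ∀ x, G x = g x := by
  let f : V r →+ V r := AddMonoidHom.mk' g ha
  let l : V r →ₗ[ZMod 2] V r := f.toZModLinearMap 2
  exact ⟨LinearEquiv.ofBijective l ⟨hg, Finite.injective_iff_surjective.mp hg⟩, fun x => rfl⟩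

/-- a map sending planes to planes is affine -/
lemma add_of_planes (g : V r → V r)
    (h : ∀ a b c d : V r, a ≠ b → a ≠ c → a ≠ d → b ≠ c → b ≠ d → c ≠ d → a + b + c + d = 0 →
      g a + g b + g c + g d = 0) (e x y : V r) :
    g (e + (x + y)) + g e = (g (e + x) + g e) + (g (e + y) + g e) := by
  by_cases hx : x = 0
  · subst hx
    simp only [zero_add, add_zero]
    linear_combination - vv (g e)
  by_cases hy : y = 0
  · subst hy
    simp only [add_zero]
    linear_combination - vv (g e)
  by_cases hxy : x = y
  · subst hxy
    rw [vv, add_zero]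
    linear_combination - vv (g (e + x))
  have := h e (e + x) (e + y) (e + (x + y)) (by simpa using hx) (by simpa using hy)
    (by simpa using fun h' => hxy (eq_of_add h')) (by simpa using hxy)
    (by simpa using hy) (by simpa using hx) (by linear_combination 2 * vv e + vv x + vv y)
  linear_combination this - vv (g (e + x)) - vv (g (e + y)) - vv (g e)

lemma lin_of_split {τ : Equiv.Perm (V r)} (h0 : τ 0 = 0) {π : Equiv.Perm (Pt r)} (h : Pres τ π)
    {p q α β : V r} (hp : π (Sum.inl p) = Sum.inl α) (hq : π (Sum.inl q) = Sum.inr β) (x y : V r) :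
    τ (x + y) = τ x + τ y := by
  have hpq : p ≠ q := by
    rintro rfl
    rw [hp] at hq
    cases hq
  have hu : p + q ≠ 0 := add_ne hpq
  have hτu : τ (p + q) ≠ 0 := fun h' => hu (τ.injective (h'.trans h0.symm))
  set s : Equiv.Perm (Pt r) := tr (p + q) (τ (p + q)) with hs
  have o2 : (1 + 1 : ZMod 2) = 0 := by decide
  -- block through p, q, z, s z
  have hblk : ∀ z : Pt r, z ≠ Sum.inl p → z ≠ Sum.inl q →
      Dst (Sum.inl p) (Sum.inl q) z (s z) ∧ Blk τ (Sum.inl p) (Sum.inl q) z (s z) := by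
    rintro (z | z) h1 h2
    · have h1' : z ≠ p := fun h => h1 (by rw [h])
      have h2' : z ≠ q := fun h => h2 (by rw [h])
      constructor
      · refine ⟨by simpa using hpq, h1.symm, ?_, h2.symm, ?_, ?_⟩
        · simp only [hs, tr, Equiv.sumCongr_apply, Sum.map_inl, ne_eq, Sum.inl.injEq,
            Equiv.coe_addRight]
          intro h
          exact h2' (by linear_combination -h - vv q)
        · simp only [hs, tr, Equiv.sumCongr_apply, Sum.map_inl, ne_eq, Sum.inl.injEq,
            Equiv.coe_addRight]
          intro h
          exact h1' (by linear_combination -h - vv p)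
        · simpa [hs, tr] using hu
      · refine ⟨by simp [hs, tr, o2], ?_⟩
        have : p + q + z + (z + (p + q)) = 0 := by linear_combination vv p + vv q + vv z
        simp [hs, tr, this, h0]
    · constructor
      · exact ⟨by simpa using hpq, by simp, by simp [hs, tr], by simp, by simp [hs, tr],
          by simpa [hs, tr] using hτu⟩
      · refine ⟨by simp [hs, tr, o2], ?_⟩
        simp only [hs, tr, Equiv.sumCongr_apply, Sum.map_inr, Equiv.coe_addRight, lc_inl, lc_inr,
          rc_inl, rc_inr, add_zero, zero_add]
        linear_combination - vv z
  set s' : Equiv.Perm (Pt r) := (π.symm.trans s).trans π with hs'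
  have hpres : Pres τ s' := ((h.symm h0).comp (tr_pres τ _ _)).comp h
  have hval : ∀ z : V r, s' (Sum.inl z) = Sum.inr (β + τ (α + z)) := by
    intro z
    by_cases hz : z = α
    · subst hz
      have : π.symm (Sum.inl z) = Sum.inl p := by rw [← hp, Equiv.symm_apply_apply]
      have h2 : s (Sum.inl p) = Sum.inl q := by
        simp only [hs, tr, Equiv.sumCongr_apply, Sum.map_inl, Equiv.coe_addRight, Sum.inl.injEq]
        linear_combination vv p
      simp [hs', this, h2, hq, vv, h0]
    · have hb := hblk (π.symm (Sum.inl z))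
        (by
          intro h'
          rw [Equiv.symm_apply_eq, hp] at h'
          exact hz (Sum.inl.inj h'))
        (by
          intro h'
          rw [Equiv.symm_apply_eq, hq] at h'
          cases h')
      have hb2 := h _ _ _ _ hb.1 hb.2
      rw [hp, hq, Equiv.apply_symm_apply] at hb2
      change Blk τ _ _ _ (s' (Sum.inl z)) at hb2
      obtain ⟨k1, k2⟩ := hb2
      rcases hw : s' (Sum.inl z) with w | w
      · rw [hw] at k1
        simp [o2] at k1
      · rw [hw] at k2
        simp only [lc_inl, lc_inr, rc_inl, rc_inr, add_zero, zero_add] at k2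
        rw [k2, Sum.inr.injEq]
        linear_combination - vv β
  have key := add_of_planes (fun z => β + τ (α + z)) (by
    intro a b c d h1 h2 h3 h4 h5 h6 hsum
    have := hpres (Sum.inl a) (Sum.inl b) (Sum.inl c) (Sum.inl d) (by simp [Dst, *])
      ⟨by simp only [sd_inl]; decide, by simp [hsum, h0]⟩
    simp only [hval] at this
    have h7 := this.2
    simp only [lc_inr, rc_inr, add_zero, h0] at h7
    exact h7.symm) α x y
  have c1 : ∀ z, α + (α + z) = z := fun z => by linear_combination vv α
  simp only [c1, vv, h0] at key
  linear_combination key + vv β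

lemma forward {τ : Equiv.Perm (V r)} (h0 : τ 0 = 0) {π : Equiv.Perm (Pt r)} (h : Pres τ π)
    (hπ : π (Sum.inl 0) = Sum.inr 0) :
    ∃ A B : V r ≃ₗ[ZMod 2] V r, ∀ x : V r, τ.symm x = A (τ (B x)) := by
  by_cases hc : ∃ p α, π (Sum.inl p) = Sum.inl α
  · obtain ⟨p, α, hp⟩ := hc
    obtain ⟨T, hT⟩ := mkLin τ τ.injective (lin_of_split h0 h hp hπ)
    refine ⟨T.symm, T.symm, fun x => ?_⟩
    rw [← hT, LinearEquiv.apply_symm_apply, Equiv.symm_apply_eq, ← hT,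
      LinearEquiv.apply_symm_apply]
  · have hg : ∀ x, ∃ y, π (Sum.inl x) = Sum.inr y := by
      intro x
      rcases hw : π (Sum.inl x) with w | w
      · exact (hc ⟨x, w, hw⟩).elim
      · exact ⟨w, rfl⟩
    choose g hg using hg
    have ginj : Function.Injective g := by
      intro x y hxy
      have : π (Sum.inl x) = π (Sum.inl y) := by rw [hg, hg, hxy]
      exact Sum.inl.inj (π.injective this)
    have gsurj := Finite.injective_iff_surjective.mp ginj
    have hh : ∀ x, ∃ y, π (Sum.inr x) = Sum.inl y := by
      intro x
      rcases hw : π (Sum.inr x) with w | w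
      · exact ⟨w, rfl⟩
      · obtain ⟨z, rfl⟩ := gsurj w
        rw [← hg] at hw
        cases π.injective hw
    choose k hk using hh
    have kinj : Function.Injective k := by
      intro x y hxy
      have : π (Sum.inr x) = π (Sum.inr y) := by rw [hk, hk, hxy]
      exact Sum.inr.inj (π.injective this)
    have gadd := add_of_planes g (by
      intro a b c d h1 h2 h3 h4 h5 h6 hsum
      have := h (Sum.inl a) (Sum.inl b) (Sum.inl c) (Sum.inl d) (by simp [Dst, *])
        ⟨by simp only [sd_inl]; decide, by simp [hsum, h0]⟩
      simp only [hg] at this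
      have h7 := this.2
      simp only [lc_inr, rc_inr, add_zero, h0] at h7
      exact h7.symm) 0
    have kadd := add_of_planes k (by
      intro a b c d h1 h2 h3 h4 h5 h6 hsum
      have := h (Sum.inr a) (Sum.inr b) (Sum.inr c) (Sum.inr d) (by simp [Dst, *])
        ⟨by simp, by simp [hsum, h0]⟩
      simp only [hk] at this
      have h7 := this.2
      simp only [lc_inl, rc_inl, add_zero] at h7
      exact τ.injective (h7.trans h0.symm)) 0
    simp only [zero_add] at gadd kadd
    obtain ⟨G, hG⟩ := mkLin (fun x => g x + g 0)
      (fun x y hxy => ginj (add_right_cancel hxy)) gadd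
    obtain ⟨K, hK⟩ := mkLin (fun x => k x + k 0)
      (fun x y hxy => kinj (add_right_cancel hxy)) kadd
    have main : ∀ x, τ (K (τ x)) = G x := by
      intro x
      by_cases hx : x = 0
      · subst hx
        simp [h0]
      have hτx : τ x ≠ 0 := fun h' => hx (τ.injective (h'.trans h0.symm))
      have o2 : (1 + 1 : ZMod 2) = 0 := by decide
      have := (h (Sum.inl x) (Sum.inl 0) (Sum.inr (τ x)) (Sum.inr 0) (by simp [Dst, *])
        ⟨by simp [o2], by simp⟩).2
      simp only [hg, hk, lc_inl, rc_inl, lc_inr, rc_inr, add_zero, zero_add] at this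
      rw [hK, hG, this]
    refine ⟨K, G.symm, fun x => ?_⟩
    rw [Equiv.symm_apply_eq, main, LinearEquiv.apply_symm_apply]

end SQSaux

open SQSaux in
/-- `SQS_τ` is point transitive iff `τ⁻¹ ∈ GL(r,2)·τ·GL(r,2)`. -/
theorem SQS_pointTransitive_iff {r : ℕ} (τ : Equiv.Perm (V r)) (h0 : τ 0 = 0) :
    SQSPointTransitive τ ↔
      ∃ A B : V r ≃ₗ[ZMod 2] V r, ∀ x : V r, τ.symm x = A (τ (B x)) := by
  constructor
  · intro h
    obtain ⟨π, h1, h2⟩ := h (Sum.inl 0) (Sum.inr 0)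
    exact forward h0 (pres_of_act h0 h1) h2
  · rintro ⟨A, B, h⟩ p p'
    suffices ∃ π, Pres τ π ∧ π p = p' by
      obtain ⟨π, h1, h2⟩ := this
      exact ⟨π, h1.act h0, h2⟩
    rcases p with a | a <;> rcases p' with b | b
    · exact ⟨tr (-a + b) 0, tr_pres _ _ _, by simp [tr]⟩
    · exact ⟨(sw A B).trans (tr 0 (-B.symm a + b)), (sw_pres τ A B h).comp (tr_pres _ _ _),
        by simp [tr, sw]⟩
    · exact ⟨(sw A B).trans (tr (-A a + b) 0), (sw_pres τ A B h).comp (tr_pres _ _ _),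
        by simp [tr, sw]⟩
    · exact ⟨tr 0 (-a + b), tr_pres _ _ _, by simp [tr]⟩
end
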